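/- The specialization L_α of a finitely generated S-module L is uniquely determined up to canonical isomorphism: if F_1 →^φ F_0 → L → 0 and G_1 →^ψ G_0 → L → 0 are two finite free presentations of L, with resulting specializations L_α = coker(φ_α) and L'_α = coker(ψ_α), then for almost all α the specialization of the identity map id_L with respect to (φ, ψ) is an isomorphism L_α ≅ L'_α, whose inverse is the specialization of id_L with respect to (ψ, φ). -/

import Mathlib

set_option maxHeartbeats 1000000
set_option synthInstance.maxHeartbeats 1000000

noncomputable section

namespace Spl

open MvPolynomial

/-- "Q(α) holds for almost all α ∈ K^m", i.e. away from a proper algebraic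
subvariety of `K^m`. -/
def AlmostAll (K : Type) [Field K] (m : ℕ) (Q : (Fin m → K) → Prop) : Prop :=
  ∃ c : MvPolynomial (Fin m) K, c ≠ 0 ∧ ∀ α : Fin m → K, MvPolynomial.eval α c ≠ 0 → Q α

variable (k K : Type) [Field k] [Field K] [Algebra k K]

/-- the field k(u) of rational functions in u = (u_1, ..., u_m) -/
abbrev kU (m : ℕ) := FractionRing (MvPolynomial (Fin m) k)

/-- the polynomial ring R = k(u)[X_1, ..., X_n] -/
abbrev Rg (m n : ℕ) := MvPolynomial (Fin n) (kU k m)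

/-- the subfield k(α) ⊆ K generated by α = (α_1, ..., α_m) over k -/
abbrev kA {m : ℕ} (α : Fin m → K) := IntermediateField.adjoin k (Set.range α)

/-- the polynomial ring R_α = k(α)[X_1, ..., X_n] -/
abbrev Ra {m : ℕ} (n : ℕ) (α : Fin m → K) := MvPolynomial (Fin n) (kA k K α)

/-- evaluation u ↦ α, from k[u] to k(α) -/
def evalα {m : ℕ} (α : Fin m → K) : MvPolynomial (Fin m) k →+* kA k K α :=
  (MvPolynomial.aeval fun i =>
    (⟨α i, IntermediateField.subset_adjoin k (Set.range α) ⟨i, rfl⟩⟩ : kA k K α)).toRingHom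

/-- the inclusion k[u][X] → R = k(u)[X] -/
def toR (m n : ℕ) : MvPolynomial (Fin n) (MvPolynomial (Fin m) k) →+* Rg k m n :=
  MvPolynomial.map (algebraMap (MvPolynomial (Fin m) k) (kU k m))

/-- substitution u ↦ α, from k[u][X] to R_α = k(α)[X] -/
def toRa {m : ℕ} (n : ℕ) (α : Fin m → K) :
    MvPolynomial (Fin n) (MvPolynomial (Fin m) k) →+* Ra k K n α :=
  MvPolynomial.map (evalα k K α)

/-- Krull's specialization I_α = { f(α,X) | f(u,X) ∈ I ∩ k[u,X] } of an ideal I ⊆ R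
(as an ideal of R_α, i.e. the ideal spanned by the specialized elements). -/
def idealSpec {m : ℕ} (n : ℕ) (α : Fin m → K) (I : Ideal (Rg k m n)) :
    Ideal (Ra k K n α) :=
  Ideal.span (toRa k K n α '' { f | toR k m n f ∈ I })

/-- `ElemSpec k K n α f fα` : fα is the specialization of f ∈ R at α, i.e. writing
f = p(u,X)/q(u) with q(α) ≠ 0 one has fα = p(α,X)/q(α). -/
def ElemSpec {m : ℕ} (n : ℕ) (α : Fin m → K) (f : Rg k m n) (fα : Ra k K n α) : Prop :=
  ∃ (p : MvPolynomial (Fin n) (MvPolynomial (Fin m) k)) (q : MvPolynomial (Fin m) k),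
    evalα k K α q ≠ 0 ∧
    MvPolynomial.C (algebraMap (MvPolynomial (Fin m) k) (kU k m) q) * f = toR k m n p ∧
    MvPolynomial.C (evalα k K α q) * fα = toRa k K n α p

variable {k K}

/-- `LocElemSpec P ℘ a aα` : aα ∈ S_α = (R_α)_℘ is the specialization of a ∈ S = R_P,
i.e. writing a = f/g with f, g ∈ R, g ∉ P, one has g_α ∉ ℘ and aα = f_α/g_α. -/
def LocElemSpec {m n : ℕ} {α : Fin m → K} (P : Ideal (Rg k m n)) [P.IsPrime]
    (℘ : Ideal (Ra k K n α)) [℘.IsPrime]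
    {S : Type} [CommRing S] [Algebra (Rg k m n) S] [IsLocalization.AtPrime S P]
    {Sα : Type} [CommRing Sα] [Algebra (Ra k K n α) Sα] [IsLocalization.AtPrime Sα ℘]
    (a : S) (aα : Sα) : Prop :=
  ∃ (f g : Rg k m n) (fα gα : Ra k K n α) (hg : g ∈ P.primeCompl)
    (hgα : gα ∈ ℘.primeCompl),
    ElemSpec k K n α f fα ∧ ElemSpec k K n α g gα ∧
    a = IsLocalization.mk' S f ⟨g, hg⟩ ∧
    aα = IsLocalization.mk' Sα fα ⟨gα, hgα⟩

/-- entrywise specialization of matrices, relative to an element-specialization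
relation `E`. -/
def MatSpec {S T : Type} (E : S → T → Prop) {r s : ℕ}
    (A : Matrix (Fin r) (Fin s) S) (B : Matrix (Fin r) (Fin s) T) : Prop :=
  ∀ i j, E (A i j) (B i j)

/-- the cokernel of the linear map attached to a matrix A, i.e. the module
presented by A. -/
abbrev MatCoker {S : Type} [CommRing S] {r s : ℕ} (A : Matrix (Fin r) (Fin s) S) :=
  (Fin r → S) ⧸ LinearMap.range A.mulVecLin

/-- a finite free presentation F_1 → F_0 → L → 0 of the module L, where the map
F_1 → F_0 is given by the matrix A and the map F_0 → L is π. -/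
structure Present (S : Type) [CommRing S] (r s : ℕ) (L : Type) [AddCommGroup L]
    [Module S L] where
  A : Matrix (Fin r) (Fin s) S
  π : (Fin r → S) →ₗ[S] L
  surj : Function.Surjective π
  ker_eq : LinearMap.ker π = LinearMap.range A.mulVecLin

theorem comm_le {S : Type} [CommRing S] {r s r' s' : ℕ} {B : Matrix (Fin r) (Fin s) S}
    {C : Matrix (Fin r') (Fin s') S} {W : Matrix (Fin r') (Fin r) S}
    {W1 : Matrix (Fin s') (Fin s) S} (h : W * B = C * W1) :
    LinearMap.range B.mulVecLin ≤ (LinearMap.range C.mulVecLin).comap W.mulVecLin := by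
  rintro x ⟨y, rfl⟩
  exact ⟨W1.mulVecLin y, by
    simp only [Matrix.mulVecLin_apply, Matrix.mulVec_mulVec, h]⟩

/-- the map between the modules presented by B and C induced by the matrix W
(a specialization of a lift of a map between the presented modules). -/
def cokerMap {S : Type} [CommRing S] {r s r' s' : ℕ} {B : Matrix (Fin r) (Fin s) S}
    {C : Matrix (Fin r') (Fin s') S} (W : Matrix (Fin r') (Fin r) S)
    (h : LinearMap.range B.mulVecLin ≤ (LinearMap.range C.mulVecLin).comap W.mulVecLin) :
    MatCoker B →ₗ[S] MatCoker C :=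
  Submodule.mapQ _ _ W.mulVecLin h

/-- a lift of a homomorphism v : L → M to given finite free presentations of L and M:
a commutative diagram whose vertical maps are given by the matrices V1, V0. -/
structure MapLift {S : Type} [CommRing S] {rL sL rM sM : ℕ} {L M : Type}
    [AddCommGroup L] [Module S L] [AddCommGroup M] [Module S M]
    (pL : Present S rL sL L) (pM : Present S rM sM M) (v : L →ₗ[S] M) where
  V0 : Matrix (Fin rM) (Fin rL) S
  V1 : Matrix (Fin sM) (Fin sL) S
  comm0 : pM.π ∘ₗ V0.mulVecLin = v ∘ₗ pL.π
  comm1 : V0 * pL.A = pM.A * V1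

/-- Krull dimension of a module, dim L = dim S/Ann L. -/
def moduleDim (S : Type) [CommRing S] (L : Type) [AddCommGroup L] [Module S L] :
    WithBot ℕ∞ :=
  ringKrullDim (S ⧸ Module.annihilator S L)

/-- height of an ideal: the infimum of dim S_p over the primes p ⊇ I. -/
def idealHeight {S : Type} [CommRing S] (I : Ideal S) : WithBot ℕ∞ :=
  sInf { d | ∃ (p : Ideal S) (hp : p.IsPrime), I ≤ p ∧
    d = ringKrullDim (Localization (@Ideal.primeCompl _ _ p hp)) }

/-- length of a module: the longest chain of submodules. -/
def moduleLength (S : Type) [CommRing S] (L : Type) [AddCommGroup L] [Module S L] :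
    WithBot ℕ∞ :=
  Order.krullDim (Submodule S L)

/-- grade(𝔞, L) ≥ t : there is an L-regular sequence of length t in 𝔞. -/
def GradeGE {S : Type} [CommRing S] (𝔞 : Ideal S) (L : Type) [AddCommGroup L]
    [Module S L] (t : ℕ) : Prop :=
  ∃ rs : List S, rs.length = t ∧ (∀ x ∈ rs, x ∈ 𝔞) ∧ RingTheory.Sequence.IsRegular L rs

/-- grade(𝔞, L) : the length of a maximal L-regular sequence in 𝔞. -/
def grade {S : Type} [CommRing S] (𝔞 : Ideal S) (L : Type) [AddCommGroup L]
    [Module S L] : ℕ∞ :=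
  sSup { t : ℕ∞ | ∃ t' : ℕ, t = (t' : ℕ∞) ∧ GradeGE 𝔞 L t' }

/-- depth of a module over a local ring: grade(𝔪, L). -/
def depth (S : Type) [CommRing S] [IsLocalRing S] (L : Type) [AddCommGroup L]
    [Module S L] : ℕ∞ :=
  grade (IsLocalRing.maximalIdeal S) L

/-- proj dim L ≤ d : L admits a finite free resolution of length ≤ d, encoded as a
(possibly infinite) free resolution ⋯ → F_1 → F_0 → L → 0 with F_j = 0 for j > d. -/
def ProjDimLE (S : Type) [CommRing S] (L : Type) [AddCommGroup L] [Module S L]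
    (d : ℕ) : Prop :=
  ∃ (r : ℕ → ℕ) (A : ∀ j : ℕ, Matrix (Fin (r j)) (Fin (r (j + 1))) S)
    (π : (Fin (r 0) → S) →ₗ[S] L),
    Function.Surjective π ∧ LinearMap.ker π = LinearMap.range (A 0).mulVecLin ∧
    (∀ j : ℕ, LinearMap.ker (A j).mulVecLin = LinearMap.range (A (j + 1)).mulVecLin) ∧
    ∀ j : ℕ, d < j → r j = 0

/-- projective dimension of a module, as an extended natural number. -/
def projDim (S : Type) [CommRing S] (L : Type) [AddCommGroup L] [Module S L] : ℕ∞ :=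
  sInf { d : ℕ∞ | ∃ d' : ℕ, d = (d' : ℕ∞) ∧ ProjDimLE S L d' }

/-- the i-th local cohomology module H^i_𝔞(L) as a module. -/
abbrev localCoh {S : Type} [CommRing S] (𝔞 : Ideal S) (i : ℕ) (L : Type)
    [AddCommGroup L] [Module S L] : ModuleCat S :=
  (localCohomology 𝔞 i).obj (ModuleCat.of S L)

/-- the colon submodule (0 :_L 𝔞) = { x ∈ L | 𝔞 x = 0 }. -/
def colonSubmodule {S : Type} [CommRing S] (𝔞 : Ideal S) (L : Type) [AddCommGroup L]
    [Module S L] : Submodule S L where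
  carrier := { x | ∀ c ∈ 𝔞, c • x = 0 }
  add_mem' := by
    intro a b ha hb c hc
    rw [smul_add, ha c hc, hb c hc, add_zero]
  zero_mem' := by
    intro c _
    rw [smul_zero]
  smul_mem' := by
    intro s x hx c hc
    rw [smul_comm, hx c hc, smul_zero]

/-- a (partial) system of parameters: the d = dim L elements a_1, ..., a_d lie in the
maximal ideal and L/(a_1, ..., a_d)L has dimension ≤ 0. -/
def IsSOP (S : Type) [CommRing S] [IsLocalRing S] (L : Type) [AddCommGroup L]
    [Module S L] {d : ℕ} (a : Fin d → S) : Prop :=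
  (∀ i, a i ∈ IsLocalRing.maximalIdeal S) ∧
  moduleDim S L = (d : ℕ∞) ∧
  moduleDim S (L ⧸ (Ideal.span (Set.range a) • (⊤ : Submodule S L))) ≤ 0

/-- a standard system of parameters: (a_1, ..., a_d) H^i_𝔪(L/(a_1, ..., a_j)L) = 0
for all i + j < d. -/
def IsStandardSOP (S : Type) [CommRing S] [IsLocalRing S] (L : Type) [AddCommGroup L]
    [Module S L] {d : ℕ} (a : Fin d → S) : Prop :=
  IsSOP S L a ∧
  ∀ i j : ℕ, i + j < d →
    Ideal.span (Set.range a) ≤ Module.annihilator S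
      (localCoh (IsLocalRing.maximalIdeal S) i
        (L ⧸ (Ideal.span (a '' { x : Fin d | (x : ℕ) < j }) • (⊤ : Submodule S L))))

/-- a standard ideal for L: an 𝔪-primary ideal 𝔞 such that every system of
parameters of L contained in 𝔞 is standard. -/
def IsStandardIdeal (S : Type) [CommRing S] [IsLocalRing S] (L : Type) [AddCommGroup L]
    [Module S L] (𝔞 : Ideal S) : Prop :=
  𝔞.radical = IsLocalRing.maximalIdeal S ∧
  ∀ (d : ℕ) (a : Fin d → S), (∀ i, a i ∈ 𝔞) → IsSOP S L a → IsStandardSOP S L a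

section Generic

variable {σ D : Type} [CommRing D]

/-- The span over `D` of the monomials divisible by no leading monomial of an element of `J`. -/
def standardSpan (μ : MonomialOrder σ) (J : Ideal (MvPolynomial σ D)) :
    Submodule D (MvPolynomial σ D) where
  carrier := { r | ∀ d ∈ r.support, ∀ b ∈ J, b ≠ 0 → ¬ μ.degree b ≤ d }
  add_mem' := by
    classical
    intro r s hr hs d hd
    rcases Finset.mem_union.1 (support_add hd) with h | h
    exacts [hr d h, hs d h]
  zero_mem' := by simp
  smul_mem' := fun _ _ hr d hd => hr d (support_smul hd)

theorem eq_zero_of_mem_standardSpan {μ : MonomialOrder σ} {J : Ideal (MvPolynomial σ D)}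
    {r : MvPolynomial σ D} (hr : r ∈ standardSpan μ J) (hJ : r ∈ J) : r = 0 := by
  by_contra h
  exact hr _ (μ.degree_mem_support h) r hJ h le_rfl

theorem exists_finset_degree_le [Finite σ] (μ : MonomialOrder σ) (J : Ideal (MvPolynomial σ D)) :
    ∃ B : Finset (MvPolynomial σ D), (∀ b ∈ B, b ∈ J ∧ b ≠ 0) ∧
      ∀ f ∈ J, f ≠ 0 → ∃ b ∈ B, μ.degree b ≤ μ.degree f := by
  classical
  let T : Set (σ →₀ ℕ) := { d | ∃ f ∈ J, f ≠ 0 ∧ μ.degree f = d }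
  have hfin : { d | Minimal (· ∈ T) d }.Finite :=
    WellQuasiOrderedLE.finite_of_isAntichain (setOfPred_minimal_antichain _)
  have hch : ∀ d, Minimal (· ∈ T) d → ∃ f ∈ J, f ≠ 0 ∧ μ.degree f = d := fun d hd => hd.1
  choose! F hF using hch
  refine ⟨hfin.toFinset.image F, ?_, ?_⟩
  · intro b hb
    obtain ⟨d, hd, rfl⟩ := Finset.mem_image.1 hb
    have := hF d (by simpa using hd)
    exact ⟨this.1, this.2.1⟩
  · intro f hf hf0
    obtain ⟨d, hd, hmin⟩ := exists_minimal_le_of_wellFoundedLT (· ∈ T) (μ.degree f) ⟨f, hf, hf0, rfl⟩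
    refine ⟨F d, Finset.mem_image_of_mem F (by simpa using hmin), ?_⟩
    rw [(hF d hmin).2.2]
    exact hd

/-- After inverting one nonzero element of `D`, the ideal `J` and the standard monomials span
the whole polynomial ring. -/
theorem exists_ne_zero_forall_smul_mem_sup [Finite σ] [IsDomain D] (μ : MonomialOrder σ)
    (J : Ideal (MvPolynomial σ D)) :
    ∃ h : D, h ≠ 0 ∧ ∀ f : MvPolynomial σ D, ∃ N : ℕ,
      h ^ N • f ∈ J.restrictScalars D ⊔ standardSpan μ J := by
  classical
  obtain ⟨B, hB, hBJ⟩ := exists_finset_degree_le μ J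
  let h : D := ∏ b ∈ B, μ.leadingCoeff b
  let G : Submodule D (MvPolynomial σ D) :=
    { carrier := { f | ∃ N : ℕ, h ^ N • f ∈ J.restrictScalars D ⊔ standardSpan μ J }
      add_mem' := by
        rintro f g ⟨N, hN⟩ ⟨M, hM⟩
        refine ⟨N + M, ?_⟩
        rw [smul_add]
        refine add_mem ?_ ?_
        · rw [add_comm, pow_add, mul_smul]; exact Submodule.smul_mem _ _ hN
        · rw [pow_add, mul_smul]; exact Submodule.smul_mem _ _ hM
      zero_mem' := ⟨0, by simp⟩
      smul_mem' := by
        rintro c f ⟨N, hN⟩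
        exact ⟨N, by rw [smul_comm]; exact Submodule.smul_mem _ _ hN⟩ }
  have hle : J.restrictScalars D ⊔ standardSpan μ J ≤ G := fun f hf => ⟨0, by simpa using hf⟩
  have hmon : ∀ d : σ →₀ ℕ, monomial d (1 : D) ∈ G := by
    intro d
    induction hd : μ.toSyn d using WellFoundedLT.induction generalizing d with
    | ind x IH =>
      subst hd
      by_cases hstd : ∃ b ∈ J, b ≠ 0 ∧ μ.degree b ≤ d
      · obtain ⟨b', hb'J, hb'0, hb'⟩ := hstd
        obtain ⟨b, hb, hbb⟩ := hBJ b' hb'J hb'0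
        obtain ⟨e, rfl⟩ := exists_add_of_le (hbb.trans hb')
        have hJ : monomial e (1 : D) * b ∈ G :=
          hle (Submodule.mem_sup_left (J.mul_mem_left _ (hB b hb).1))
        have hsum : monomial e (1 : D) * b =
            μ.leadingCoeff b • monomial (μ.degree b + e) (1 : D) +
            ∑ c ∈ b.support.erase (μ.degree b), b.coeff c • monomial (c + e) (1 : D) := by
          conv_lhs => rw [b.as_sum, Finset.mul_sum]
          rw [← Finset.add_sum_erase _ _ (μ.degree_mem_support (hB b hb).2)]
          simp [monomial_mul, smul_monomial, MonomialOrder.leadingCoeff, add_comm]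
        have hlow : ∑ c ∈ b.support.erase (μ.degree b), b.coeff c • monomial (c + e) (1 : D) ∈ G := by
          refine Submodule.sum_mem _ fun c hc => Submodule.smul_mem _ _ ?_
          refine IH _ ?_ _ rfl
          obtain ⟨hne, hc⟩ := Finset.mem_erase.1 hc
          have := lt_of_le_of_ne (μ.le_degree hc) (fun h => hne (μ.toSyn.injective h))
          rw [map_add, map_add]
          exact add_lt_add_left this _
        have hlead : μ.leadingCoeff b • monomial (μ.degree b + e) (1 : D) ∈ G := by
          rw [hsum] at hJ
          exact (Submodule.add_mem_iff_left _ hlow).1 hJ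
        obtain ⟨N, hN⟩ := G.smul_mem (∏ b ∈ B.erase b, μ.leadingCoeff b) hlead
        refine ⟨N + 1, ?_⟩
        rwa [smul_smul (∏ b ∈ B.erase b, μ.leadingCoeff b), Finset.prod_erase_mul _ _ hb, smul_smul,
          ← pow_succ] at hN
      · push Not at hstd
        refine hle (Submodule.mem_sup_right fun c hc b hb hb0 => ?_)
        obtain rfl := Finset.mem_singleton.1 (support_monomial_subset hc)
        exact hstd b hb hb0
  refine ⟨h, Finset.prod_ne_zero_iff.2 fun b hb =>
    MonomialOrder.leadingCoeff_ne_zero_iff.2 (hB b hb).2, fun f => ?_⟩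
  change f ∈ G
  rw [f.as_sum]
  refine Submodule.sum_mem _ fun c _ => ?_
  rw [← mul_one (coeff c f), ← smul_eq_mul, ← smul_monomial]
  exact G.smul_mem _ (hmon c)

/-- A form of generic flatness: after inverting one nonzero element `h` of `D`, every element of
`J` with coefficients in an ideal `𝔞` lies in `𝔞 J`. -/
theorem exists_ne_zero_forall_pow_smul_mem_smul [Finite σ] [IsDomain D]
    (J : Ideal (MvPolynomial σ D)) :
    ∃ h : D, h ≠ 0 ∧ ∀ (𝔞 : Ideal D), ∀ c ∈ J, (∀ d, c.coeff d ∈ 𝔞) →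
      ∃ N : ℕ, h ^ N • c ∈ 𝔞 • J.restrictScalars D := by
  classical
  let : LinearOrder σ := linearOrderOfSTO WellOrderingRel
  have : WellFoundedGT σ := Finite.to_wellFoundedGT
  let μ : MonomialOrder σ := MonomialOrder.lex
  obtain ⟨h, h0, hh⟩ := exists_ne_zero_forall_smul_mem_sup μ J
  refine ⟨h, h0, fun 𝔞 c hc hcoeff => ?_⟩
  choose N hN using fun d : σ →₀ ℕ => hh (monomial d 1)
  let M := ∑ d ∈ c.support, N d
  have hM : ∀ d ∈ c.support, h ^ M • monomial d (1 : D) ∈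
      J.restrictScalars D ⊔ standardSpan μ J := by
    intro d hd
    have : M = (M - N d) + N d := (Nat.sub_add_cancel (Finset.single_le_sum (by simp) hd)).symm
    rw [this, pow_add, mul_smul]
    exact Submodule.smul_mem _ _ (hN d)
  have hM' : ∀ d, ∃ π ρ, d ∈ c.support → π ∈ J ∧ ρ ∈ standardSpan μ J ∧
      π + ρ = h ^ M • monomial d (1 : D) := by
    intro d
    by_cases hd : d ∈ c.support
    · obtain ⟨π, hπ, ρ, hρ, e⟩ := Submodule.mem_sup.1 (hM d hd)
      exact ⟨π, ρ, fun _ => ⟨hπ, hρ, e⟩⟩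
    · exact ⟨0, 0, fun h => absurd h hd⟩
  choose π ρ hπρ using hM'
  have hsum : h ^ M • c =
      ∑ d ∈ c.support, c.coeff d • π d + ∑ d ∈ c.support, c.coeff d • ρ d := by
    conv_lhs => rw [c.as_sum]
    rw [Finset.smul_sum, ← Finset.sum_add_distrib]
    refine Finset.sum_congr rfl fun d hd => ?_
    rw [← smul_add, (hπρ d hd).2.2]
    simp [smul_monomial, mul_comm]
  have hJ : ∑ d ∈ c.support, c.coeff d • π d ∈ J :=
    Submodule.sum_mem (J.restrictScalars D) fun d hd => Submodule.smul_mem _ _ (hπρ d hd).1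
  have hρ0 : ∑ d ∈ c.support, c.coeff d • ρ d = 0 := by
    refine eq_zero_of_mem_standardSpan (μ := μ) (J := J)
      (Submodule.sum_mem _ fun d hd => Submodule.smul_mem _ _ (hπρ d hd).2.1) ?_
    rw [← sub_eq_iff_eq_add'.2 hsum]
    exact sub_mem (Submodule.smul_mem (J.restrictScalars D) _ hc) hJ
  refine ⟨M, ?_⟩
  rw [hsum, hρ0, add_zero]
  exact Submodule.sum_mem _ fun d hd => Submodule.smul_mem_smul (hcoeff d) (hπρ d hd).1

theorem exists_map_eq_C_mul {κ : Type} [Field κ] {φ : D →+* κ}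
    (hφ : ∀ x : κ, ∃ a b, φ b ≠ 0 ∧ φ b * x = φ a) (f : MvPolynomial σ κ) :
    ∃ (b : D) (f' : MvPolynomial σ D), φ b ≠ 0 ∧ C (φ b) * f = map φ f' := by
  induction f using MvPolynomial.induction_on with
  | C x =>
    obtain ⟨a, b, hb, e⟩ := hφ x
    exact ⟨b, C a, hb, by rw [← C_mul, e, map_C]⟩
  | add f g hf hg =>
    obtain ⟨b, f', hb, hf⟩ := hf
    obtain ⟨c, g', hc, hg⟩ := hg
    refine ⟨b * c, C c * f' + C b * g', by simp [hb, hc], ?_⟩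
    simp only [map_mul, map_add, map_C, ← hf, ← hg]
    ring
  | mul_X f i hf =>
    obtain ⟨b, f', hb, hf⟩ := hf
    exact ⟨b, f' * X i, hb, by rw [← mul_assoc, hf, map_mul, map_X]⟩

theorem exists_C_mul_eq_map_of_mem_map {κ : Type} [Field κ] {φ : D →+* κ}
    (hφ : ∀ x : κ, ∃ a b, φ b ≠ 0 ∧ φ b * x = φ a) {I : Ideal (MvPolynomial σ D)}
    {f : MvPolynomial σ κ} (hf : f ∈ I.map (map φ)) :
    ∃ (b : D) (f' : MvPolynomial σ D), φ b ≠ 0 ∧ f' ∈ I ∧ C (φ b) * f = map φ f' := by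
  induction hf using Submodule.span_induction with
  | mem x hx =>
    obtain ⟨i, hi, rfl⟩ := hx
    exact ⟨1, i, by simp, hi, by simp⟩
  | zero => exact ⟨1, 0, by simp, I.zero_mem, by simp⟩
  | add f g _ _ hf hg =>
    obtain ⟨b, f', hb, hfI, hf⟩ := hf
    obtain ⟨c, g', hc, hgI, hg⟩ := hg
    refine ⟨b * c, C c * f' + C b * g', by simp [hb, hc],
      I.add_mem (I.mul_mem_left _ hfI) (I.mul_mem_left _ hgI), ?_⟩
    simp only [map_mul, map_add, map_C, ← hf, ← hg]
    ring
  | smul r f _ hf =>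
    obtain ⟨b, f', hb, hfI, hf⟩ := hf
    obtain ⟨c, r', hc, hr⟩ := exists_map_eq_C_mul hφ r
    refine ⟨b * c, r' * f', by simp [hb, hc], I.mul_mem_left _ hfI, ?_⟩
    simp only [map_mul, ← hf, ← hr, smul_eq_mul]
    ring

theorem mem_of_C_mul_mem {κ : Type} [Field κ] {I : Ideal (MvPolynomial σ κ)} {a : κ} (ha : a ≠ 0)
    {f : MvPolynomial σ κ} (h : C a * f ∈ I) : f ∈ I := by
  have := I.mul_mem_left (C a⁻¹) h
  rwa [← mul_assoc, ← C_mul, inv_mul_cancel₀ ha, C_1, one_mul] at this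

theorem exists_add_mul_of_mem_ker_smul {κ : Type} [Field κ] {φ : D →+* κ}
    {I : Ideal (MvPolynomial σ D)} {g x : MvPolynomial σ D}
    (hx : x ∈ RingHom.ker φ • (I ⊔ Ideal.span {g}).restrictScalars D) :
    ∃ i ∈ I, ∃ b, map φ b = 0 ∧ x = i + g * b := by
  induction hx using Submodule.smul_induction_on' with
  | smul r hr y hy =>
    obtain ⟨i, hi, z, hz, rfl⟩ := Submodule.mem_sup.1 hy
    obtain ⟨b, rfl⟩ := Ideal.mem_span_singleton.1 hz
    refine ⟨r • i, Submodule.smul_of_tower_mem I r hi, r • b, ?_, ?_⟩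
    · rw [smul_eq_C_mul, map_mul, map_C, RingHom.mem_ker.1 hr, C_0, zero_mul]
    · rw [smul_add, mul_smul_comm]
  | add x _ y _ hx hy =>
    obtain ⟨i, hi, b, hb, rfl⟩ := hx
    obtain ⟨j, hj, c, hc, rfl⟩ := hy
    exact ⟨i + j, I.add_mem hi hj, b + c, by rw [map_add, hb, hc, add_zero], by ring⟩

/-- An element `g` outside a prime ideal `I` stays a nonzerodivisor modulo `I` in almost all
fibres over `D`. -/
theorem exists_ne_zero_forall_mem_map_of_mul_mem [Finite σ] [IsDomain D]
    {I : Ideal (MvPolynomial σ D)} (hI : I.IsPrime) {g : MvPolynomial σ D} (hg : g ∉ I) :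
    ∃ h : D, h ≠ 0 ∧ ∀ (κ : Type) [Field κ] (φ : D →+* κ),
      (∀ x : κ, ∃ a b, φ b ≠ 0 ∧ φ b * x = φ a) → φ h ≠ 0 →
      ∀ f, map φ g * f ∈ I.map (map φ) → f ∈ I.map (map φ) := by
  obtain ⟨h, h0, hh⟩ := exists_ne_zero_forall_pow_smul_mem_smul (I ⊔ Ideal.span {g})
  refine ⟨h, h0, fun κ _ φ hφ hφh f hf => ?_⟩
  obtain ⟨b, f', hb, hf'⟩ := exists_map_eq_C_mul hφ f
  obtain ⟨c, i, hc, hi, hci⟩ := exists_C_mul_eq_map_of_mem_map hφ hf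
  have hzero : map φ (C c * (f' * g) - C b * i) = 0 := by
    simp only [map_sub, map_mul, map_C, ← hf', ← hci]
    ring
  obtain ⟨N, hN⟩ := hh (RingHom.ker φ) (C c * (f' * g) - C b * i)
    (sub_mem (Ideal.mul_mem_left _ _ (Ideal.mul_mem_left _ _
      (Ideal.mem_sup_right (Ideal.mem_span_singleton_self g))))
      (Ideal.mul_mem_left _ _ (Ideal.mem_sup_left hi)))
    fun d => by rw [RingHom.mem_ker, ← coeff_map, hzero, coeff_zero]
  obtain ⟨j, hj, e, he, hje⟩ := exists_add_mul_of_mem_ker_smul hN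
  have hmem : g * (C (h ^ N) * C c * f' - e) ∈ I := by
    have : g * (C (h ^ N) * C c * f' - e) = j + C (h ^ N) * C b * i := by
      rw [smul_eq_C_mul] at hje
      linear_combination hje
    rw [this]
    exact I.add_mem hj (I.mul_mem_left _ hi)
  have hmap := Ideal.mem_map_of_mem (map φ) ((hI.mem_or_mem hmem).resolve_left hg)
  rw [map_sub, he, sub_zero, map_mul, map_mul, map_C, map_C, map_pow, ← hf'] at hmap
  refine mem_of_C_mul_mem (mul_ne_zero (mul_ne_zero (pow_ne_zero N hφh) hc) hb) ?_
  rwa [C_mul, C_mul, mul_assoc]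

end Generic

section Specialization

variable {k K : Type} [Field k] [Field K] [Algebra k K] {m n : ℕ}

theorem toR_injective : Function.Injective (toR k m n) :=
  map_injective _ (IsFractionRing.injective _ _)

theorem coe_evalα (α : Fin m → K) (a : MvPolynomial (Fin m) k) :
    ((evalα k K α a : kA k K α) : K) = aeval α a :=
  MvPolynomial.comp_aeval_apply _ (kA k K α).val a

theorem exists_evalα_mul_eq (α : Fin m → K) (x : kA k K α) :
    ∃ a b, evalα k K α b ≠ 0 ∧ evalα k K α b * x = evalα k K α a := by
  obtain ⟨r, s, hx⟩ := (IntermediateField.mem_adjoin_range_iff k α x.1).1 x.2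
  by_cases hs : aeval α s = 0
  · refine ⟨0, 1, by simp, ?_⟩
    rw [hs, div_zero] at hx
    simp [Subtype.ext_iff, hx]
  · refine ⟨r, s, fun h => hs (by rw [← coe_evalα, h]; rfl), Subtype.ext ?_⟩
    rw [MulMemClass.coe_mul, coe_evalα, coe_evalα, hx, mul_div_cancel₀ _ hs]

theorem evalα_ne_zero {α : Fin m → K} {h : MvPolynomial (Fin m) k}
    (hα : eval α (map (algebraMap k K) h) ≠ 0) : evalα k K α h ≠ 0 := by
  rw [eval_map, ← aeval_def, ← coe_evalα] at hα
  exact fun h0 => hα (by rw [h0]; rfl)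

theorem exists_C_mul_eq_toR (f : Rg k m n) :
    ∃ (b : MvPolynomial (Fin m) k) (f' : MvPolynomial (Fin n) (MvPolynomial (Fin m) k)),
      b ≠ 0 ∧ C (algebraMap _ (kU k m) b) * f = toR k m n f' := by
  obtain ⟨b, f', hb, h⟩ := exists_map_eq_C_mul (φ := algebraMap (MvPolynomial (Fin m) k) (kU k m))
    (fun x => by
      obtain ⟨a, b, hb, rfl⟩ := IsFractionRing.div_surjective (A := MvPolynomial (Fin m) k) x
      have hb' : algebraMap _ (kU k m) b ≠ 0 :=
        IsFractionRing.to_map_ne_zero_of_mem_nonZeroDivisors hb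
      exact ⟨a, b, hb', mul_div_cancel₀ _ hb'⟩) f
  exact ⟨b, f', fun h0 => hb (by rw [h0, map_zero]), h⟩

theorem exists_ne_zero_forall_toRa_notMem (P : Ideal (Rg k m n)) [P.IsPrime]
    {g : MvPolynomial (Fin n) (MvPolynomial (Fin m) k)} (hg : toR k m n g ∉ P) :
    ∃ h : MvPolynomial (Fin m) k, h ≠ 0 ∧ ∀ α : Fin m → K, evalα k K α h ≠ 0 →
      ∀ ℘ : Ideal (Ra k K n α), IsAssociatedPrime ℘ (Ra k K n α ⧸ idealSpec k K n α P) →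
        toRa k K n α g ∉ ℘ := by
  obtain ⟨h, h0, hh⟩ := exists_ne_zero_forall_mem_map_of_mul_mem
    (I := P.comap (toR k m n)) inferInstance hg
  refine ⟨h, h0, fun α hα ℘ h℘ hmem => ?_⟩
  obtain ⟨hprime, x, hx⟩ := isAssociatedPrime_iff.1 h℘
  obtain ⟨f, rfl⟩ := Ideal.Quotient.mk_surjective x
  have hspec : idealSpec k K n α P = (P.comap (toR k m n)).map (map (evalα k K α)) := rfl
  have key : ∀ r, r ∈ ℘ ↔ r * f ∈ idealSpec k K n α P := fun r => by
    rw [hx, Submodule.mem_colon_singleton, Submodule.mem_bot, ← Ideal.Quotient.eq_zero_iff_mem]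
    rfl
  refine hprime.ne_top ((Ideal.eq_top_iff_one _).2 ((key 1).2 ?_))
  rw [one_mul, hspec]
  exact hh _ _ (exists_evalα_mul_eq α) hα f ((key _).1 hmem)

/-- The pairs `(a, b)` with `a = p(u,X)/g(u,X)` in `S` and `b = p(α,X)/g(α,X)` in `Sα`. -/
def specSubring {α : Fin m → K} (P : Ideal (Rg k m n)) [P.IsPrime] (℘ : Ideal (Ra k K n α))
    [℘.IsPrime] (S Sα : Type) [CommRing S] [Algebra (Rg k m n) S] [CommRing Sα]
    [Algebra (Ra k K n α) Sα] : Subring (S × Sα) where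
  carrier := { x | ∃ p g, toR k m n g ∉ P ∧ toRa k K n α g ∉ ℘ ∧
    x.1 * algebraMap _ S (toR k m n g) = algebraMap _ S (toR k m n p) ∧
    x.2 * algebraMap _ Sα (toRa k K n α g) = algebraMap _ Sα (toRa k K n α p) }
  zero_mem' := ⟨0, 1, by simpa using P.one_notMem, by simpa using ℘.one_notMem, by simp, by simp⟩
  one_mem' := ⟨1, 1, by simpa using P.one_notMem, by simpa using ℘.one_notMem, by simp, by simp⟩
  add_mem' := by
    rintro ⟨a, b⟩ ⟨c, d⟩ ⟨p, g, hg, hg', h, h'⟩ ⟨p₁, g₁, hg₁, hg₁', h₁, h₁'⟩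
    refine ⟨p * g₁ + p₁ * g, g * g₁, ?_, ?_, ?_, ?_⟩
    · rw [map_mul]; exact ‹P.IsPrime›.mul_notMem hg hg₁
    · rw [map_mul]; exact ‹℘.IsPrime›.mul_notMem hg' hg₁'
    · simp only [map_add, map_mul, ← h, ← h₁, Prod.fst_add]; ring
    · simp only [map_add, map_mul, ← h', ← h₁', Prod.snd_add]; ring
  mul_mem' := by
    rintro ⟨a, b⟩ ⟨c, d⟩ ⟨p, g, hg, hg', h, h'⟩ ⟨p₁, g₁, hg₁, hg₁', h₁, h₁'⟩
    refine ⟨p * p₁, g * g₁, ?_, ?_, ?_, ?_⟩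
    · rw [map_mul]; exact ‹P.IsPrime›.mul_notMem hg hg₁
    · rw [map_mul]; exact ‹℘.IsPrime›.mul_notMem hg' hg₁'
    · simp only [map_mul, ← h, ← h₁, Prod.fst_mul]; ring
    · simp only [map_mul, ← h', ← h₁', Prod.snd_mul]; ring
  neg_mem' := by
    rintro ⟨a, b⟩ ⟨p, g, hg, hg', h, h'⟩
    refine ⟨-p, g, hg, hg', ?_, ?_⟩
    · simp only [map_neg, ← h, Prod.fst_neg, neg_mul]
    · simp only [map_neg, ← h', Prod.snd_neg, neg_mul]

section Fibre

variable {α : Fin m → K} {P : Ideal (Rg k m n)} [P.IsPrime] {℘ : Ideal (Ra k K n α)} [℘.IsPrime]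
  {S : Type} [CommRing S] [Algebra (Rg k m n) S]
  {Sα : Type} [CommRing Sα] [Algebra (Ra k K n α) Sα]

theorem eq_zero_of_mem_specSubring [IsLocalization.AtPrime S P] [IsLocalization.AtPrime Sα ℘]
    {b : Sα} (h : ((0 : S), b) ∈ specSubring P ℘ S Sα) : b = 0 := by
  obtain ⟨p, g, _, hg, h0, hb⟩ := h
  have hp : p = 0 := by
    apply toR_injective (k := k) (m := m) (n := n)
    apply IsLocalization.injective S P.primeCompl_le_nonZeroDivisors
    rw [← h0, zero_mul, map_zero, map_zero]
  have hu : IsUnit (algebraMap (Ra k K n α) Sα (toRa k K n α g)) :=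
    IsLocalization.map_units Sα (⟨_, hg⟩ : ℘.primeCompl)
  rw [hp, map_zero, map_zero] at hb
  exact (hu.mul_left_eq_zero).1 hb

theorem LocElemSpec.mem_specSubring [IsLocalization.AtPrime S P] [IsLocalization.AtPrime Sα ℘]
    {a : S} {aα : Sα} (h : LocElemSpec P ℘ a aα) : (a, aα) ∈ specSubring P ℘ S Sα := by
  obtain ⟨f, g, fα, gα, hg, hgα, ⟨p, q, hq, hf, hfα⟩, ⟨p', q', hq', hg', hgα'⟩, rfl, rfl⟩ := h
  have hq0 : ∀ r : MvPolynomial (Fin m) k, evalα k K α r ≠ 0 → algebraMap _ (kU k m) r ≠ 0 :=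
    fun r hr h0 => hr (by
      rw [IsFractionRing.injective _ (kU k m) (h0.trans (map_zero _).symm), map_zero])
  have hR : ∀ r, toR k m n (C r) = C (algebraMap _ (kU k m) r) := fun r => map_C _ _
  have hRa : ∀ r, toRa k K n α (C r) = C (evalα k K α r) := fun r => map_C _ _
  refine ⟨C q' * p, C q * p', fun hmem => hg ?_, fun hmem => hgα ?_, ?_, ?_⟩
  · rw [map_mul, hR, ← hg'] at hmem
    exact mem_of_C_mul_mem (hq0 _ hq') (mem_of_C_mul_mem (hq0 _ hq) hmem)
  · rw [map_mul, hRa, ← hgα'] at hmem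
    exact mem_of_C_mul_mem hq' (mem_of_C_mul_mem hq hmem)
  · have := IsLocalization.mk'_spec S f (⟨g, hg⟩ : P.primeCompl)
    simp only [map_mul, hR, ← hf, ← hg', ← this]
    ring
  · have := IsLocalization.mk'_spec Sα fα (⟨gα, hgα⟩ : ℘.primeCompl)
    simp only [map_mul, hRa, ← hfα, ← hgα', ← this]
    ring

theorem MatSpec.mono {S T : Type} {E E' : S → T → Prop} (hE : ∀ a b, E a b → E' a b) {r s : ℕ}
    {A : Matrix (Fin r) (Fin s) S} {B : Matrix (Fin r) (Fin s) T} (h : MatSpec E A B) :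
    MatSpec E' A B := fun i j => hE _ _ (h i j)

theorem MatSpec.mul {S T : Type} [CommRing S] [CommRing T] {Γ : Subring (S × T)} {r s t : ℕ}
    {A : Matrix (Fin r) (Fin s) S} {B : Matrix (Fin r) (Fin s) T}
    {A' : Matrix (Fin s) (Fin t) S} {B' : Matrix (Fin s) (Fin t) T}
    (h : MatSpec (fun a b => (a, b) ∈ Γ) A B) (h' : MatSpec (fun a b => (a, b) ∈ Γ) A' B') :
    MatSpec (fun a b => (a, b) ∈ Γ) (A * A') (B * B') := fun i j => by
  have := Γ.sum_mem fun l (_ : l ∈ Finset.univ) => Γ.mul_mem (h i l) (h' l j)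
  change ((A * A') i j, (B * B') i j) ∈ Γ
  rwa [show ((A * A') i j, (B * B') i j) = ∑ l, (A i l, B i l) * (A' l j, B' l j) from
    Prod.ext (by simp [Matrix.mul_apply, Prod.fst_sum]) (by simp [Matrix.mul_apply, Prod.snd_sum])]

theorem MatSpec.add {S T : Type} [CommRing S] [CommRing T] {Γ : Subring (S × T)} {r s : ℕ}
    {A A' : Matrix (Fin r) (Fin s) S} {B B' : Matrix (Fin r) (Fin s) T}
    (h : MatSpec (fun a b => (a, b) ∈ Γ) A B) (h' : MatSpec (fun a b => (a, b) ∈ Γ) A' B') :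
    MatSpec (fun a b => (a, b) ∈ Γ) (A + A') (B + B') :=
  fun i j => Γ.add_mem (h i j) (h' i j)

theorem MatSpec.one {S T : Type} [CommRing S] [CommRing T] {Γ : Subring (S × T)} {r : ℕ} :
    MatSpec (fun a b => (a, b) ∈ Γ) (1 : Matrix (Fin r) (Fin r) S) 1 := fun i j => by
  simp only [Matrix.one_apply]
  split_ifs
  exacts [Γ.one_mem, Γ.zero_mem]

theorem MatSpec.eq_of_eq [IsLocalization.AtPrime S P] [IsLocalization.AtPrime Sα ℘] {r s : ℕ}
    {A A' : Matrix (Fin r) (Fin s) S} {B B' : Matrix (Fin r) (Fin s) Sα}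
    (h : MatSpec (fun a b => (a, b) ∈ specSubring P ℘ S Sα) A B)
    (h' : MatSpec (fun a b => (a, b) ∈ specSubring P ℘ S Sα) A' B') (hA : A = A') : B = B' := by
  subst hA
  ext i j
  have := (specSubring P ℘ S Sα).sub_mem (h i j) (h' i j)
  rw [Prod.mk_sub_mk, sub_self] at this
  exact sub_eq_zero.1 (eq_zero_of_mem_specSubring this)

end Fibre

theorem exists_ne_zero_forall_exists_mem_specSubring (P : Ideal (Rg k m n)) [P.IsPrime]
    {S : Type} [CommRing S] [Algebra (Rg k m n) S] [IsLocalization.AtPrime S P] (a : S) :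
    ∃ h : MvPolynomial (Fin m) k, h ≠ 0 ∧ ∀ α : Fin m → K, evalα k K α h ≠ 0 →
      ∀ (℘ : Ideal (Ra k K n α)) [℘.IsPrime],
        IsAssociatedPrime ℘ (Ra k K n α ⧸ idealSpec k K n α P) →
        ∀ (Sα : Type) [CommRing Sα] [Algebra (Ra k K n α) Sα] [IsLocalization.AtPrime Sα ℘],
          ∃ b : Sα, (a, b) ∈ specSubring P ℘ S Sα := by
  obtain ⟨f, ⟨g, hg⟩, rfl⟩ := IsLocalization.exists_mk'_eq P.primeCompl a
  obtain ⟨b, f', hb, hf⟩ := exists_C_mul_eq_toR f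
  obtain ⟨c, g', hc, hg'⟩ := exists_C_mul_eq_toR g
  have hR : ∀ r, toR k m n (C r) = C (algebraMap _ (kU k m) r) := fun r => map_C _ _
  have h0 : ∀ r : MvPolynomial (Fin m) k, r ≠ 0 → algebraMap _ (kU k m) r ≠ 0 := fun r hr =>
    IsFractionRing.to_map_eq_zero_iff.not.2 hr
  have hden : toR k m n (C b * g') ∉ P := fun hmem => hg (by
    rw [map_mul, hR, ← hg'] at hmem
    exact mem_of_C_mul_mem (h0 _ hc) (mem_of_C_mul_mem (h0 _ hb) hmem))
  obtain ⟨h, hne, hh⟩ := exists_ne_zero_forall_toRa_notMem (K := K) P hden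
  refine ⟨h, hne, fun α hα ℘ _ h℘ Sα _ _ _ => ?_⟩
  have hmem := hh α hα ℘ h℘
  refine ⟨IsLocalization.mk' Sα (toRa k K n α (C c * f')) (⟨_, hmem⟩ : ℘.primeCompl),
    C c * f', C b * g', hden, hmem, ?_, IsLocalization.mk'_spec Sα _ _⟩
  have := IsLocalization.mk'_spec S f (⟨g, hg⟩ : P.primeCompl)
  simp only [map_mul, hR, ← hf, ← hg', ← this]
  ring

theorem exists_ne_zero_forall_exists_matSpec (P : Ideal (Rg k m n)) [P.IsPrime]
    {S : Type} [CommRing S] [Algebra (Rg k m n) S] [IsLocalization.AtPrime S P]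
    {r s : ℕ} (A : Matrix (Fin r) (Fin s) S) :
    ∃ h : MvPolynomial (Fin m) k, h ≠ 0 ∧ ∀ α : Fin m → K, evalα k K α h ≠ 0 →
      ∀ (℘ : Ideal (Ra k K n α)) [℘.IsPrime],
        IsAssociatedPrime ℘ (Ra k K n α ⧸ idealSpec k K n α P) →
        ∀ (Sα : Type) [CommRing Sα] [Algebra (Ra k K n α) Sα] [IsLocalization.AtPrime Sα ℘],
          ∃ B : Matrix (Fin r) (Fin s) Sα,
            MatSpec (fun a b => (a, b) ∈ specSubring P ℘ S Sα) A B := by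
  choose h h0 hh using fun i j =>
    exists_ne_zero_forall_exists_mem_specSubring (K := K) P (A i j)
  refine ⟨∏ i, ∏ j, h i j, Finset.prod_ne_zero_iff.2 fun i _ =>
    Finset.prod_ne_zero_iff.2 fun j _ => h0 i j, fun α hα ℘ _ h℘ Sα _ _ _ => ?_⟩
  simp only [map_prod, Finset.prod_ne_zero_iff, Finset.mem_univ, true_imp_iff] at hα
  choose B hB using fun i j => hh i j α (hα i j) ℘ h℘ Sα
  exact ⟨Matrix.of B, hB⟩

end Specialization

section Lifts

variable {S : Type} [CommRing S] {L : Type} [AddCommGroup L] [Module S L] {r s r' s' : ℕ}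

theorem Present.exists_mul_eq (p : Present S r s L) (M : Matrix (Fin r) (Fin r') S)
    (h : p.π ∘ₗ M.mulVecLin = 0) : ∃ H : Matrix (Fin s) (Fin r') S, M = p.A * H := by
  have hcol : ∀ j, ∃ y, p.A.mulVecLin y = M.mulVecLin (Pi.single j 1) := fun j => by
    rw [← LinearMap.mem_range, ← p.ker_eq, LinearMap.mem_ker]
    exact LinearMap.congr_fun h _
  choose H hH using hcol
  refine ⟨Matrix.of fun i j => H j i, ?_⟩
  ext i j
  have := congr_fun (hH j) i
  simpa [Matrix.mulVec, dotProduct, Matrix.mul_apply, Pi.single_apply] using this.symm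

theorem MapLift.exists_mul_eq_add_one {p : Present S r s L} {q : Present S r' s' L}
    (l₁ : MapLift p q LinearMap.id) (l₂ : MapLift q p LinearMap.id) :
    ∃ H, l₂.V0 * l₁.V0 = p.A * H + 1 := by
  obtain ⟨H, hH⟩ := p.exists_mul_eq (l₂.V0 * l₁.V0 - 1) (by
    have h₁ := l₁.comm0
    have h₂ := l₂.comm0
    rw [LinearMap.id_comp] at h₁ h₂
    refine LinearMap.ext fun x => ?_
    have h₁x := LinearMap.congr_fun h₁
    have h₂x := LinearMap.congr_fun h₂
    simp only [LinearMap.comp_apply, Matrix.mulVecLin_apply] at h₁x h₂x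
    rw [LinearMap.comp_apply, Matrix.mulVecLin_apply, Matrix.sub_mulVec, Matrix.one_mulVec,
      ← Matrix.mulVec_mulVec, map_sub, h₂x, h₁x, sub_self, LinearMap.zero_apply])
  exact ⟨H, sub_eq_iff_eq_add.1 hH⟩

theorem cokerMap_comp_eq_id {B : Matrix (Fin r) (Fin s) S} {C : Matrix (Fin r') (Fin s') S}
    {W : Matrix (Fin r') (Fin r) S} {Z : Matrix (Fin r) (Fin r') S} {H : Matrix (Fin s) (Fin r) S}
    (hW : LinearMap.range B.mulVecLin ≤ (LinearMap.range C.mulVecLin).comap W.mulVecLin)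
    (hZ : LinearMap.range C.mulVecLin ≤ (LinearMap.range B.mulVecLin).comap Z.mulVecLin)
    (h : Z * W = B * H + 1) : cokerMap Z hZ ∘ₗ cokerMap W hW = LinearMap.id := by
  refine Submodule.linearMap_qext _ (LinearMap.ext fun x => ?_)
  simp only [cokerMap, LinearMap.comp_apply, Submodule.mkQ_apply, Submodule.mapQ_apply,
    LinearMap.id_apply, Matrix.mulVecLin_apply, Matrix.mulVec_mulVec]
  refine (Submodule.Quotient.eq _).2 ⟨H.mulVec x, ?_⟩
  rw [Matrix.mulVecLin_apply, Matrix.mulVec_mulVec, h, Matrix.add_mulVec, Matrix.one_mulVec,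
    add_sub_cancel_right]

end Lifts

/-- uniqueness of the specialization of a module up to canonical
isomorphism.  Given two finite free presentations `p` (with matrix `φ = p.A`) and
`q` (with matrix `ψ = q.A`) of a finitely generated `S`-module `L`, and lifts of
`id_L` in both directions, for almost all `α` the specializations of `id_L` with
respect to `(φ, ψ)` and `(ψ, φ)` are mutually inverse isomorphisms between the two
specializations `L_α = coker φ_α` and `L'_α = coker ψ_α` of `L`. -/
theorem specialization_unique_up_to_canonical_iso
    (k K : Type) [Field k] [Field K] [Algebra k K] [Infinite K] {m n : ℕ}
    (P : Ideal (Rg k m n)) [P.IsPrime]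
    (S : Type) [CommRing S] [Algebra (Rg k m n) S] [IsLocalization.AtPrime S P]
    (L : Type) [AddCommGroup L] [Module S L] [Module.Finite S L]
    {r0 s0 r1 s1 : ℕ}
    (p : Present S r0 s0 L) (q : Present S r1 s1 L)
    (l1 : MapLift p q LinearMap.id) (l2 : MapLift q p LinearMap.id) :
    AlmostAll K m fun α =>
      ∀ (℘ : Ideal (Ra k K n α))
        (h℘ : IsAssociatedPrime ℘ ((Ra k K n α) ⧸ idealSpec k K n α P)),
        haveI := h℘.isPrime
        ∀ (Sα : Type) [CommRing Sα] [Algebra (Ra k K n α) Sα]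
          [IsLocalization.AtPrime Sα ℘]
          (B : Matrix (Fin r0) (Fin s0) Sα) (C : Matrix (Fin r1) (Fin s1) Sα)
          (W0 : Matrix (Fin r1) (Fin r0) Sα) (W1 : Matrix (Fin s1) (Fin s0) Sα)
          (Z0 : Matrix (Fin r0) (Fin r1) Sα) (Z1 : Matrix (Fin s0) (Fin s1) Sα),
          MatSpec (LocElemSpec P ℘) p.A B → MatSpec (LocElemSpec P ℘) q.A C →
          MatSpec (LocElemSpec P ℘) l1.V0 W0 → MatSpec (LocElemSpec P ℘) l1.V1 W1 →
          MatSpec (LocElemSpec P ℘) l2.V0 Z0 → MatSpec (LocElemSpec P ℘) l2.V1 Z1 →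
          ∃ (h1 : W0 * B = C * W1) (h2 : Z0 * C = B * Z1),
            cokerMap Z0 (comm_le h2) ∘ₗ cokerMap W0 (comm_le h1) = LinearMap.id ∧
            cokerMap W0 (comm_le h1) ∘ₗ cokerMap Z0 (comm_le h2) = LinearMap.id := by
  obtain ⟨H, hH⟩ := l1.exists_mul_eq_add_one l2
  obtain ⟨H', hH'⟩ := l2.exists_mul_eq_add_one l1
  obtain ⟨h, h0, hh⟩ := exists_ne_zero_forall_exists_matSpec (K := K) P H
  obtain ⟨h', h0', hh'⟩ := exists_ne_zero_forall_exists_matSpec (K := K) P H'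
  refine ⟨map (algebraMap k K) (h * h'), ?_, ?_⟩
  · exact (map_ne_zero_iff _ (map_injective _ (algebraMap k K).injective)).2 (mul_ne_zero h0 h0')
  intro α hα ℘ h℘ Sα _ _ _ B C W0 W1 Z0 Z1 hB hC hW0 hW1 hZ0 hZ1
  have := h℘.isPrime
  have hev := evalα_ne_zero hα
  rw [map_mul] at hev
  obtain ⟨Hα, hHα⟩ := hh α (left_ne_zero_of_mul hev) ℘ h℘ Sα
  obtain ⟨Hα', hHα'⟩ := hh' α (right_ne_zero_of_mul hev) ℘ h℘ Sα
  have hE : ∀ (a : S) (b : Sα), LocElemSpec P ℘ a b → (a, b) ∈ specSubring P ℘ S Sα :=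
    fun _ _ => LocElemSpec.mem_specSubring
  replace hB := hB.mono hE
  replace hC := hC.mono hE
  replace hW0 := hW0.mono hE
  replace hZ0 := hZ0.mono hE
  exact ⟨(hW0.mul hB).eq_of_eq (hC.mul (hW1.mono hE)) l1.comm1,
    (hZ0.mul hC).eq_of_eq (hB.mul (hZ1.mono hE)) l2.comm1,
    cokerMap_comp_eq_id _ _ ((hZ0.mul hW0).eq_of_eq ((hB.mul hHα).add MatSpec.one) hH),
    cokerMap_comp_eq_id _ _ ((hW0.mul hZ0).eq_of_eq ((hC.mul hHα').add MatSpec.one) hH')⟩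

end Spl
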